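/- For every integer N ≥ 2, the infimum of the objective F over the feasible set of the identity-bridge reformulated problem (constraints: f1 ≥ 1, l1 ≥ 1, m1 ≥ 1, l1 + l2 + α ≥ f1 + f2 + β + 1, f1 + f2 ≥ l1 + l2 + 1, m1 + m2 ≥ g1 + g2 + 1, and m1 + m2 ≥ g2 + 1) equals the infimum of the objective G over the feasible set of the identity-bridge lower-bound problem. -/

import Mathlib

/-- The objective `G` of the lower-bound problems:
`G = √((c_fl² + c_mg² + N·c_ba²)/2) + (N−1)·√((f1−m1)² + (g1−l1)² + 4t)`. -/
noncomputable def Gobj (N : ℕ) (f1 g1 l1 m1 cfl cmg cba t : ℝ) : ℝ :=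
  Real.sqrt ((cfl ^ 2 + cmg ^ 2 + N * cba ^ 2) / 2) +
    ((N : ℝ) - 1) * Real.sqrt ((f1 - m1) ^ 2 + (g1 - l1) ^ 2 + 4 * t)

/-- The objective `F` (the nuclear norm in closed form). -/
noncomputable def Fobj (N : ℕ) (f1 f2 g1 g2 l1 l2 m1 m2 β α : ℝ) : ℝ :=
  let CA1 : ℝ := f1 ^ 2 + g1 ^ 2
  let CA2 : ℝ := 2 * f1 * f2 + N * f2 ^ 2 + 2 * g1 * g2 + N * g2 ^ 2 + β ^ 2
  let CD1 : ℝ := l1 ^ 2 + m1 ^ 2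
  let CD2 : ℝ := 2 * l1 * l2 + N * l2 ^ 2 + 2 * m1 * m2 + N * m2 ^ 2 + α ^ 2
  let CB1 : ℝ := f1 * l1 + g1 * m1
  let CB2 : ℝ := f1 * l2 + f2 * l1 + N * f2 * l2 + g1 * m2 + g2 * m1 + N * g2 * m2 + β * α
  Real.sqrt (CA1 + N * CA2 + CD1 + N * CD2 +
      2 * Real.sqrt ((CA1 + N * CA2) * (CD1 + N * CD2) - (CB1 + N * CB2) ^ 2)) +
    ((N : ℝ) - 1) * Real.sqrt (CA1 + CD1 + 2 * |f1 * m1 - g1 * l1|)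

/-- Feasible set of the identity-bridge lower-bound problem. -/
def FeasIdnLB (N : ℕ) (f1 g1 l1 m1 cfl cmg cba t : ℝ) : Prop :=
  1 ≤ f1 ∧ 1 ≤ l1 ∧ 1 ≤ m1 ∧
  ((N : ℝ) - 1) * f1 + cfl + N * cba + N ≤ ((N : ℝ) - 1) * l1 ∧
  ((N : ℝ) - 1) * l1 + N ≤ ((N : ℝ) - 1) * f1 + cfl ∧
  ((N : ℝ) - 1) * g1 + N ≤ ((N : ℝ) - 1) * m1 + cmg ∧
  -g1 + N ≤ ((N : ℝ) - 1) * m1 + cmg ∧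
  f1 * m1 ≤ t ∧
  g1 * l1 ≤ t

/-- Writing `t` for `max (f1 * m1) (g1 * l1)`, the second radicand of `F` is that of `G`. -/
theorem sq_add_two_abs_eq_max (f1 g1 l1 m1 : ℝ) :
    f1 ^ 2 + g1 ^ 2 + (l1 ^ 2 + m1 ^ 2) + 2 * |f1 * m1 - g1 * l1| =
      (f1 - m1) ^ 2 + (g1 - l1) ^ 2 + 4 * max (f1 * m1) (g1 * l1) := by
  rcases le_total (f1 * m1) (g1 * l1) with h | h
  · rw [max_eq_right h, abs_of_nonpos (sub_nonpos.2 h)]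
    ring
  · rw [max_eq_left h, abs_of_nonneg (sub_nonneg.2 h)]
    ring

/-- With `t = max (f1 * m1) (g1 * l1)` and the differences of the averaged coefficients,
`G` bounds `F` from below. -/
theorem Gobj_le_Fobj (N : ℕ) (f1 f2 g1 g2 l1 l2 m1 m2 β α : ℝ) :
    Gobj N f1 g1 l1 m1 (f1 + N * f2 - (l1 + N * l2)) (m1 + N * m2 - (g1 + N * g2)) (β - α)
      (max (f1 * m1) (g1 * l1)) ≤ Fobj N f1 f2 g1 g2 l1 l2 m1 m2 β α := by
  simp only [Gobj, Fobj]
  rw [sq_add_two_abs_eq_max]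
  gcongr ?_ + _
  refine Real.sqrt_le_sqrt (le_trans ?_ (le_add_of_nonneg_right (by positivity)))
  nlinarith [sq_nonneg (f1 + N * f2 + (l1 + N * l2)), sq_nonneg (m1 + N * m2 + (g1 + N * g2)),
    mul_nonneg (Nat.cast_nonneg (α := ℝ) N) (sq_nonneg (β + α))]

/-- At the antisymmetric choice of averaged coefficients, `F` is bounded above by `G`. -/
theorem Fobj_le_Gobj (N : ℕ) (hN : 2 ≤ N) {f1 g1 l1 m1 cfl cmg cba t : ℝ}
    (hfm : f1 * m1 ≤ t) (hgl : g1 * l1 ≤ t) :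
    Fobj N f1 ((cfl / 2 - f1) / N) g1 ((-cmg / 2 - g1) / N) l1 ((-cfl / 2 - l1) / N)
      m1 ((cmg / 2 - m1) / N) (cba / 2) (-cba / 2) ≤ Gobj N f1 g1 l1 m1 cfl cmg cba t := by
  have hN0 : (N : ℝ) ≠ 0 := by positivity
  have hN1 : (0 : ℝ) ≤ N - 1 := by
    have : (2 : ℝ) ≤ N := by exact_mod_cast hN
    linarith
  simp only [Gobj, Fobj]
  rw [sq_add_two_abs_eq_max]
  refine add_le_add (Real.sqrt_le_sqrt ?_) (mul_le_mul_of_nonneg_left (Real.sqrt_le_sqrt ?_) hN1)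
  · rw [Real.sqrt_eq_zero_of_nonpos (le_of_eq (by field_simp; ring))]
    apply le_of_eq
    field_simp
    ring
  · gcongr
    exact max_le hfm hgl

/-- The infimum of `F` over the feasible set of the
identity-bridge reformulated problem (constraints `f1 ≥ 1`, `l1 ≥ 1`,
`m1 ≥ 1`, `l1 + l2 + α ≥ f1 + f2 + β + 1`, `f1 + f2 ≥ l1 + l2 + 1`,
`m1 + m2 ≥ g1 + g2 + 1`, `m1 + m2 ≥ g2 + 1`) equals the infimum of `G` over
the feasible set of the identity-bridge lower-bound problem. -/
theorem identity_bridge_lower_bound_same_value (N : ℕ) (hN : 2 ≤ N) :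
    sInf {y : ℝ | ∃ f1 f2 g1 g2 l1 l2 m1 m2 β α : ℝ,
        (1 ≤ f1 ∧ 1 ≤ l1 ∧ 1 ≤ m1 ∧
          f1 + f2 + β + 1 ≤ l1 + l2 + α ∧
          l1 + l2 + 1 ≤ f1 + f2 ∧
          g1 + g2 + 1 ≤ m1 + m2 ∧
          g2 + 1 ≤ m1 + m2) ∧
        y = Fobj N f1 f2 g1 g2 l1 l2 m1 m2 β α} =
    sInf {y : ℝ | ∃ f1 g1 l1 m1 cfl cmg cba t : ℝ,
        FeasIdnLB N f1 g1 l1 m1 cfl cmg cba t ∧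
        y = Gobj N f1 g1 l1 m1 cfl cmg cba t} := by
  apply csInf_eq_csInf_of_forall_exists_le
  · rintro _ ⟨f1, f2, g1, g2, l1, l2, m1, m2, β, α, ⟨hf, hl, hm, h1, h2, h3, h4⟩, rfl⟩
    refine ⟨_, ⟨f1, g1, l1, m1, _, _, _, _, ⟨hf, hl, hm, ?_, ?_, ?_, ?_, le_max_left _ _,
      le_max_right _ _⟩, rfl⟩, Gobj_le_Fobj N f1 f2 g1 g2 l1 l2 m1 m2 β α⟩
    · linarith [mul_le_mul_of_nonneg_left h1 (Nat.cast_nonneg (α := ℝ) N)]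
    · linarith [mul_le_mul_of_nonneg_left h2 (Nat.cast_nonneg (α := ℝ) N)]
    · linarith [mul_le_mul_of_nonneg_left h3 (Nat.cast_nonneg (α := ℝ) N)]
    · linarith [mul_le_mul_of_nonneg_left h4 (Nat.cast_nonneg (α := ℝ) N)]
  · rintro _ ⟨f1, g1, l1, m1, cfl, cmg, cba, t, ⟨hf, hl, hm, h1, h2, h3, h4, hfm, hgl⟩, rfl⟩
    have hN0 : (0 : ℝ) < N := by positivity
    refine ⟨_, ⟨f1, _, g1, _, l1, _, m1, _, _, _, ⟨hf, hl, hm, ?_, ?_, ?_, ?_⟩, rfl⟩,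
      Fobj_le_Gobj N hN hfm hgl⟩
    all_goals
      rw [← sub_nonneg]
      refine nonneg_of_mul_nonneg_right ?_ hN0
      field_simp
      linarith
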